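/- For |q|<1, E(q^2)^4/E(q)^2 - q E(q^{10})^4/E(q^5)^2 = E(q^2) E(q^5)^3/(E(q) E(q^{10})), where E(q) = ∏_{k≥0}(1-q^{k+1}). -/

import Mathlib

/-- Euler's product E(q) = ∏_{k≥0} (1 - q^{k+1}). -/
noncomputable def E (q : ℂ) : ℂ := ∏' k : ℕ, (1 - q ^ (k + 1))

/-- q-Pochhammer infinite product (a;q)_∞ = ∏_{k≥0} (1 - a q^k). -/
noncomputable def qp (a q : ℂ) : ℂ := ∏' k : ℕ, (1 - a * q ^ k)

/-- Rogers–Ramanujan function G(q) = 1/((q,q^4;q^5)_∞). -/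
noncomputable def G (q : ℂ) : ℂ := 1 / (qp q (q ^ 5) * qp (q ^ 4) (q ^ 5))

/-- Rogers–Ramanujan function H(q) = 1/((q^2,q^3;q^5)_∞). -/
noncomputable def H (q : ℂ) : ℂ := 1 / (qp (q ^ 2) (q ^ 5) * qp (q ^ 3) (q ^ 5))

/-- Rogers–Ramanujan continued fraction product R(q). -/
noncomputable def R (q : ℂ) : ℂ :=
  (qp q (q ^ 5) * qp (q ^ 4) (q ^ 5)) / (qp (q ^ 2) (q ^ 5) * qp (q ^ 3) (q ^ 5))

open Filter Topology

section InfiniteProducts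

theorem summable_norm_mul_geometric {q : ℂ} (hq : ‖q‖ < 1) (a : ℂ) :
    Summable fun k : ℕ => ‖-(a * q ^ k)‖ := by
  simpa only [norm_neg, norm_mul, norm_pow] using
    (summable_geometric_of_lt_one (norm_nonneg q) hq).mul_left ‖a‖

theorem multipliable_qp {q : ℂ} (hq : ‖q‖ < 1) (a : ℂ) :
    Multipliable fun k : ℕ => 1 - a * q ^ k := by
  simpa only [sub_eq_add_neg] using
    multipliable_one_add_of_summable (summable_norm_mul_geometric hq a)

theorem tendsto_qp {q : ℂ} (hq : ‖q‖ < 1) (a : ℂ) :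
    Tendsto (fun n => ∏ k ∈ Finset.range n, (1 - a * q ^ k)) atTop (𝓝 (qp a q)) :=
  (multipliable_qp hq a).hasProd.tendsto_prod_nat

theorem E_eq_qp (q : ℂ) : E q = qp q q := by
  simp only [E, qp, pow_succ']

theorem one_sub_pow_succ_ne_zero {q : ℂ} (hq : ‖q‖ < 1) (k : ℕ) : 1 - q ^ (k + 1) ≠ 0 := by
  intro h
  have h1 : ‖q ^ (k + 1)‖ = 1 := by rw [← sub_eq_zero.mp h, norm_one]
  rw [norm_pow] at h1
  exact (pow_lt_one₀ (norm_nonneg q) hq k.succ_ne_zero).ne h1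

theorem E_ne_zero {q : ℂ} (hq : ‖q‖ < 1) : E q ≠ 0 := by
  rw [E_eq_qp]
  have := tprod_one_add_ne_zero_of_summable (f := fun k : ℕ => -(q * q ^ k))
    (fun k => by
      simpa only [← sub_eq_add_neg, ← pow_succ'] using one_sub_pow_succ_ne_zero hq k)
    (summable_norm_mul_geometric hq q)
  simpa only [qp, sub_eq_add_neg] using this

theorem qp_eq_one_sub_mul {q : ℂ} (hq : ‖q‖ < 1) (a : ℂ) : qp a q = (1 - a) * qp (a * q) q := by
  refine tendsto_nhds_unique ((tendsto_qp hq a).comp (tendsto_add_atTop_nat 1)) ?_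
  refine ((tendsto_qp hq (a * q)).const_mul (1 - a)).congr fun n => ?_
  rw [Function.comp_apply, Finset.prod_range_succ', mul_comm]
  simp only [pow_zero, mul_one, pow_succ', mul_assoc]

theorem E_mul_qp_neg {q : ℂ} (hq : ‖q‖ < 1) : E q * qp (-q) q = E (q ^ 2) := by
  have hq2 : ‖q ^ 2‖ < 1 := by
    rw [norm_pow]; exact pow_lt_one₀ (norm_nonneg q) hq two_ne_zero
  rw [E_eq_qp, E_eq_qp]
  refine tendsto_nhds_unique ((tendsto_qp hq q).mul (tendsto_qp hq (-q))) ?_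
  refine (tendsto_qp hq2 (q ^ 2)).congr fun n => ?_
  rw [← Finset.prod_mul_distrib]
  exact Finset.prod_congr rfl fun k _ => by ring

theorem qp_eq_prod_five {q : ℂ} (hq : ‖q‖ < 1) (a : ℂ) :
    qp a q = qp a (q ^ 5) * qp (a * q) (q ^ 5) * qp (a * q ^ 2) (q ^ 5) * qp (a * q ^ 3) (q ^ 5)
      * qp (a * q ^ 4) (q ^ 5) := by
  have hq5 : ‖q ^ 5‖ < 1 := by
    rw [norm_pow]; exact pow_lt_one₀ (norm_nonneg q) hq (by norm_num)
  have hlim : Tendsto (fun n : ℕ => 5 * n) atTop atTop :=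
    tendsto_id.const_mul_atTop' (by norm_num)
  refine tendsto_nhds_unique ((tendsto_qp hq a).comp hlim) ?_
  refine (((((tendsto_qp hq5 a).mul (tendsto_qp hq5 (a * q))).mul
    (tendsto_qp hq5 (a * q ^ 2))).mul (tendsto_qp hq5 (a * q ^ 3))).mul
    (tendsto_qp hq5 (a * q ^ 4))).congr fun n => ?_
  induction n with
  | zero => simp
  | succ n ih =>
    rw [Function.comp_apply] at ih ⊢
    rw [show 5 * (n + 1) = 5 * n + 1 + 1 + 1 + 1 + 1 by ring]
    simp only [Finset.prod_range_succ, ← ih]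
    ring

end InfiniteProducts

section TripleProduct

/-- The triangular number `j (j - 1) / 2`. -/
def triangular (j : ℤ) : ℤ := j * (j - 1) / 2

theorem two_mul_triangular (j : ℤ) : 2 * triangular j = j * (j - 1) :=
  Int.two_mul_ediv_two_of_even (Int.even_mul_pred_self j)

theorem triangular_add_one (j : ℤ) : triangular (j + 1) = triangular j + j := by
  apply mul_left_cancel₀ (two_ne_zero' ℤ)
  linear_combination two_mul_triangular (j + 1) - two_mul_triangular j

/-- The finite product `(q;q)_n`. -/
noncomputable def qpFin (q : ℂ) (n : ℕ) : ℂ := ∏ k ∈ Finset.range n, (1 - q ^ (k + 1))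

theorem qpFin_ne_zero {q : ℂ} (hq : ‖q‖ < 1) (n : ℕ) : qpFin q n ≠ 0 :=
  Finset.prod_ne_zero_iff.mpr fun k _ => one_sub_pow_succ_ne_zero hq k

theorem tendsto_qpFin {q : ℂ} (hq : ‖q‖ < 1) : Tendsto (qpFin q) atTop (𝓝 (E q)) := by
  rw [E_eq_qp]
  refine (tendsto_qp hq q).congr fun n => ?_
  simp only [qpFin, pow_succ']

/-- The reciprocal of `(q;q)_m`, extended by zero to negative `m`. -/
noncomputable def qpRecip (q : ℂ) (m : ℤ) : ℂ := if m < 0 then 0 else (qpFin q m.toNat)⁻¹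

theorem qpRecip_sub_one {q : ℂ} (hq : ‖q‖ < 1) (m : ℤ) :
    qpRecip q (m - 1) = (1 - q ^ m) * qpRecip q m := by
  rcases lt_trichotomy m 0 with hm | rfl | hm
  · simp [qpRecip, hm, show m - 1 < 0 by omega]
  · simp [qpRecip]
  · obtain ⟨k, rfl⟩ : ∃ k : ℕ, m = k + 1 := ⟨(m - 1).toNat, by omega⟩
    have h1 : ¬ ((k : ℤ) + 1 < 0) := by omega
    have h2 : ((k : ℤ) + 1).toNat = k + 1 := by omega
    have h3 := one_sub_pow_succ_ne_zero hq k
    have h4 := qpFin_ne_zero hq k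
    have h5 : qpFin q (k + 1) = qpFin q k * (1 - q ^ (k + 1)) := Finset.prod_range_succ _ _
    have h6 : q ^ ((k : ℤ) + 1) = q ^ (k + 1) := by exact_mod_cast zpow_natCast q (k + 1)
    simp only [qpRecip, add_sub_cancel_right, h1, h2, h5, h6, if_false, Int.toNat_natCast,
      show ¬ ((k : ℤ) < 0) by omega]
    field_simp

theorem tendsto_qpRecip {q : ℂ} (hq : ‖q‖ < 1) : Tendsto (qpRecip q) atTop (𝓝 (E q)⁻¹) := by
  have hlim : Tendsto Int.toNat atTop atTop :=
    tendsto_atTop_atTop.mpr fun n => ⟨n, fun m hm => by omega⟩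
  have h := ((tendsto_qpFin hq).comp hlim).inv₀ (E_ne_zero hq)
  refine h.congr' ?_
  filter_upwards [eventually_ge_atTop 0] with m hm
  simp [qpRecip, not_lt.mpr hm]

theorem exists_norm_qpFin_le {q : ℂ} (hq : ‖q‖ < 1) : ∃ C, ∀ n, ‖qpFin q n‖ ≤ C := by
  obtain ⟨C, hC⟩ := (tendsto_qpFin hq).norm.bddAbove_range
  exact ⟨C, fun n => hC ⟨n, rfl⟩⟩

theorem exists_norm_qpRecip_le {q : ℂ} (hq : ‖q‖ < 1) : ∃ C, ∀ m, ‖qpRecip q m‖ ≤ C := by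
  obtain ⟨C, hC⟩ := ((tendsto_qpFin hq).inv₀ (E_ne_zero hq)).norm.bddAbove_range
  refine ⟨C, fun m => ?_⟩
  have h : ∀ n, ‖(qpFin q n)⁻¹‖ ≤ C := fun n => hC ⟨n, rfl⟩
  unfold qpRecip
  split_ifs
  · simpa using (norm_nonneg _).trans (h 0)
  · exact h _

/-- The central `q`-binomial coefficient `[2n choose n + j]`. -/
noncomputable def qCentral (q : ℂ) (n : ℕ) (j : ℤ) : ℂ :=
  qpFin q (2 * n) * (qpRecip q (n - j) * qpRecip q (n + j))

theorem qCentral_succ {q : ℂ} (hq0 : q ≠ 0) (hq : ‖q‖ < 1) (n : ℕ) (j : ℤ) :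
    qCentral q (n + 1) j = (1 + q ^ (2 * n + 1)) * qCentral q n j
      + q ^ ((n : ℤ) - j + 1) * qCentral q n (j - 1)
      + q ^ ((n : ℤ) + j + 1) * qCentral q n (j + 1) := by
  have hA := qpRecip_sub_one hq (n - j + 1)
  have hA' := qpRecip_sub_one hq (n - j)
  have hB := qpRecip_sub_one hq (n + j + 1)
  have hB' := qpRecip_sub_one hq (n + j)
  rw [add_sub_cancel_right] at hA hB
  have hP : qpFin q (2 * (n + 1))
      = qpFin q (2 * n) * (1 - q ^ (2 * n + 1)) * (1 - q ^ (2 * n + 2)) := by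
    rw [show 2 * (n + 1) = 2 * n + 1 + 1 by ring]
    simp only [qpFin, Finset.prod_range_succ]
  have hAB : q ^ ((n : ℤ) - j + 1) * q ^ ((n : ℤ) + j) = q ^ (2 * n + 1) := by
    rw [← zpow_add₀ hq0, ← zpow_natCast]
    congr 1
    push_cast
    ring
  simp only [qCentral, hP, Nat.cast_add, Nat.cast_one]
  rw [show (n : ℤ) + 1 - j = n - j + 1 by ring, show (n : ℤ) + 1 + j = n + j + 1 by ring,
    show (n : ℤ) - (j - 1) = n - j + 1 by ring, show (n : ℤ) + (j - 1) = n + j - 1 by ring,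
    show (n : ℤ) - (j + 1) = n - j - 1 by ring, show (n : ℤ) + (j + 1) = n + j + 1 by ring,
    hA', hB', hA, hB, pow_succ q (2 * n + 1), ← hAB]
  rw [zpow_add_one₀ hq0, zpow_add_one₀ hq0]
  ring

theorem hasSum_finite_triple_product {q z : ℂ} (hq0 : q ≠ 0) (hq : ‖q‖ < 1) (hz : z ≠ 0) (n : ℕ) :
    HasSum (fun j : ℤ => qCentral q n j * (q ^ triangular j * z ^ j))
      ((∏ k ∈ Finset.range n, (1 - -z * q ^ k)) * ∏ k ∈ Finset.range n, (1 - -(z⁻¹ * q) * q ^ k)) := by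
  induction n with
  | zero =>
    convert hasSum_single (f := fun j : ℤ => qCentral q 0 j * (q ^ triangular j * z ^ j)) 0 ?_ using 1
    · simp [qCentral, qpFin, qpRecip, triangular]
    · intro j hj
      rcases lt_or_gt_of_ne hj with h | h <;> simp [qCentral, qpRecip, h]
  | succ n ih =>
    have h1 := ih.mul_left (1 + q ^ (2 * n + 1))
    have h2 := ((Equiv.subRight (1 : ℤ)).hasSum_iff.mpr ih).mul_left (q ^ n * z)
    have h3 := ((Equiv.addRight (1 : ℤ)).hasSum_iff.mpr ih).mul_left (q ^ (n + 1) * z⁻¹)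
    convert (h1.add h2).add h3 using 1
    · rfl
    · funext j
      have hT := triangular_add_one j
      have hT' := triangular_add_one (j - 1)
      rw [sub_add_cancel] at hT'
      simp only [Function.comp_apply, Equiv.subRight_apply, Equiv.coe_addRight]
      rw [qCentral_succ hq0 hq, hT, show triangular (j - 1) = triangular j + (1 - j) by omega,
        show (n : ℤ) - j + 1 = n + (1 - j) by ring, zpow_add₀ hq0 n (1 - j),
        zpow_add₀ hq0 (triangular j) (1 - j), zpow_add₀ hq0 (triangular j) j,
        zpow_add_one₀ hq0 (n + j), zpow_add₀ hq0 n j, zpow_sub_one₀ hz, zpow_add_one₀ hz,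
        zpow_natCast, pow_succ q n]
      field_simp
    · rw [Finset.prod_range_succ, Finset.prod_range_succ]
      field_simp
      ring

theorem summable_norm_theta {q z : ℂ} (hq : ‖q‖ < 1) (hq0 : q ≠ 0) (hz : z ≠ 0) :
    Summable fun j : ℤ => ‖q ^ triangular j * z ^ j‖ := by
  have hpow := tendsto_pow_atTop_nhds_zero_of_lt_one (norm_nonneg q) hq
  have hne : ∀ j : ℤ, ‖q ^ triangular j * z ^ j‖ ≠ 0 := fun j =>
    norm_ne_zero_iff.mpr (mul_ne_zero (zpow_ne_zero _ hq0) (zpow_ne_zero _ hz))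
  refine Summable.of_nat_of_neg ?_ ?_
  · refine summable_of_ratio_test_tendsto_lt_one zero_lt_one (.of_forall fun n => hne n)
      (l := 0) ?_
    have := hpow.mul_const ‖z‖
    rw [zero_mul] at this
    refine this.congr fun n => ?_
    rw [norm_norm, norm_norm, eq_div_iff (hne n), ← norm_pow, ← norm_mul, ← norm_mul]
    congr 1
    push_cast
    rw [triangular_add_one, zpow_add₀ hq0, zpow_add_one₀ hz, zpow_natCast q]
    ring
  · refine summable_of_ratio_test_tendsto_lt_one zero_lt_one (.of_forall fun n => hne (-n))
      (l := 0) ?_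
    have := (hpow.comp (tendsto_add_atTop_nat 1)).mul_const ‖z⁻¹‖
    rw [zero_mul] at this
    refine this.congr fun n => ?_
    rw [norm_norm, norm_norm, eq_div_iff (hne (-n)), Function.comp_apply, ← norm_pow, ← norm_mul,
      ← norm_mul]
    congr 1
    have hT := triangular_add_one (-(n : ℤ) - 1)
    rw [sub_add_cancel] at hT
    push_cast
    rw [neg_add', show triangular (-(n : ℤ) - 1) = triangular (-n) + (n + 1) by omega,
      zpow_add₀ hq0, zpow_sub_one₀ hz, zpow_add_one₀ hq0, zpow_natCast, pow_succ]
    ring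

/-- The **Jacobi triple product** identity. -/
theorem tsum_theta_eq {q z : ℂ} (hq0 : q ≠ 0) (hq : ‖q‖ < 1) (hz : z ≠ 0) :
    ∑' j : ℤ, q ^ triangular j * z ^ j = E q * (qp (-z) q * qp (-(z⁻¹ * q)) q) := by
  obtain ⟨C, hC⟩ := exists_norm_qpFin_le hq
  obtain ⟨D, hD⟩ := exists_norm_qpRecip_le hq
  have hlim : Tendsto (fun n : ℕ => ∑' j : ℤ, qCentral q n j * (q ^ triangular j * z ^ j)) atTop
      (𝓝 (∑' j : ℤ, (E q)⁻¹ * (q ^ triangular j * z ^ j))) := by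
    refine tendsto_tsum_of_dominated_convergence
      (bound := fun j => C * (D * D) * ‖q ^ triangular j * z ^ j‖)
      ((summable_norm_theta hq hq0 hz).mul_left _) (fun j => ?_) (.of_forall fun n j => ?_)
    · refine Tendsto.mul_const _ ?_
      have h1 := (tendsto_qpFin hq).comp (tendsto_id.const_mul_atTop' (zero_lt_two' ℕ))
      have h2 := (tendsto_qpRecip hq).comp
        (tendsto_atTop_add_const_right atTop (-j) tendsto_natCast_atTop_atTop)
      have h3 := (tendsto_qpRecip hq).comp
        (tendsto_atTop_add_const_right atTop j tendsto_natCast_atTop_atTop)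
      have h := h1.mul (h2.mul h3)
      rwa [mul_inv_cancel_left₀ (E_ne_zero hq)] at h
    · rw [norm_mul, qCentral, norm_mul, norm_mul]
      have hC0 := (norm_nonneg _).trans (hC 0)
      have hD0 := (norm_nonneg _).trans (hD 0)
      gcongr
      exacts [hC _, hD _, hD _]
  have hprod := (tendsto_qp hq (-z)).mul (tendsto_qp hq (-(z⁻¹ * q)))
  have := tendsto_nhds_unique hlim
    (hprod.congr fun n => (hasSum_finite_triple_product hq0 hq hz n).tsum_eq.symm)
  rw [tsum_mul_left] at this
  rw [← this, mul_inv_cancel_left₀ (E_ne_zero hq)]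

end TripleProduct

section Quintisection

/-- The parametrisations of the five cosets of the index-five sublattice of `ℤ × ℤ` on which
`a + 2 * b` is divisible by five. -/
def latticeCoset : Fin 5 × (ℤ × ℤ) → ℤ × ℤ
  | (0, m, n) => (2 * m + n - 1, 2 * n - m)
  | (1, m, n) => (2 * m - n, 1 - 2 * n - m)
  | (2, m, n) => (2 * n + m, 2 * m - n)
  | (3, m, n) => (1 - 2 * m + n, 2 * n + m)
  | (4, m, n) => (1 - 2 * n - m, 1 - 2 * m + n)

theorem latticeCoset_bijective : Function.Bijective latticeCoset := by
  constructor
  · rintro ⟨i, m, n⟩ ⟨j, m', n'⟩ h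
    fin_cases i <;> fin_cases j <;> simp [latticeCoset] at h ⊢ <;> omega
  · rintro ⟨a, b⟩
    have h : (a + 2 * b) % 5 = 0 ∨ (a + 2 * b) % 5 = 1 ∨ (a + 2 * b) % 5 = 2 ∨
        (a + 2 * b) % 5 = 3 ∨ (a + 2 * b) % 5 = 4 := by omega
    rcases h with h | h | h | h | h
    · exact ⟨(2, (a + 2 * b) / 5, (2 * a - b) / 5), by simp [latticeCoset]; omega⟩
    · exact ⟨(3, (2 - 2 * a + b) / 5, (a + 2 * b - 1) / 5), by simp [latticeCoset]; omega⟩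
    · exact ⟨(1, (2 * a - b + 1) / 5, (2 - a - 2 * b) / 5), by simp [latticeCoset]; omega⟩
    · exact ⟨(4, (3 - a - 2 * b) / 5, (1 - 2 * a + b) / 5), by simp [latticeCoset]; omega⟩
    · exact ⟨(0, (2 * a - b + 2) / 5, (a + 2 * b + 1) / 5), by simp [latticeCoset]; omega⟩

theorem triangular_add_triangular_central (m n : ℤ) :
    triangular (2 * m + n - 1) + triangular (2 * n - m)
      = 1 + (5 * triangular m + 5 * triangular n) := by
  apply mul_left_cancel₀ (two_ne_zero' ℤ)
  linear_combination two_mul_triangular (2 * m + n - 1) + two_mul_triangular (2 * n - m)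
    - 5 * two_mul_triangular m - 5 * two_mul_triangular n

theorem triangular_one_sub (j : ℤ) : triangular (1 - j) = triangular j := by
  apply mul_left_cancel₀ (two_ne_zero' ℤ)
  linear_combination two_mul_triangular (1 - j) - two_mul_triangular j

theorem triangular_add_triangular_lateral (m n : ℤ) :
    triangular (2 * m - n) + triangular (2 * n + m)
      = (5 * triangular m + m) + (5 * triangular n + 2 * n) := by
  apply mul_left_cancel₀ (two_ne_zero' ℤ)
  linear_combination two_mul_triangular (2 * m - n) + two_mul_triangular (2 * n + m)
    - 5 * two_mul_triangular m - 5 * two_mul_triangular n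

theorem triangular_latticeCoset_of_ne_zero {i : Fin 5} (hi : i ≠ 0) (m n : ℤ) :
    triangular (latticeCoset (i, m, n)).1 + triangular (latticeCoset (i, m, n)).2
      = (5 * triangular m + m) + (5 * triangular n + 2 * n) := by
  have h := triangular_add_triangular_lateral m n
  have h1 := triangular_one_sub (2 * m - n)
  have h2 := triangular_one_sub (2 * n + m)
  rw [← sub_add] at h1
  rw [← sub_sub] at h2
  fin_cases i <;> simp [latticeCoset] at hi ⊢ <;> omega

theorem tsum_theta_sq {q : ℂ} (hq0 : q ≠ 0) (hq : ‖q‖ < 1) :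
    (∑' j : ℤ, q ^ triangular j * 1 ^ j) ^ 2
      = q * (∑' j : ℤ, (q ^ 5) ^ triangular j * 1 ^ j) ^ 2
        + 4 * ((∑' j : ℤ, (q ^ 5) ^ triangular j * q ^ j)
          * ∑' j : ℤ, (q ^ 5) ^ triangular j * (q ^ 2) ^ j) := by
  have hq5 : ‖q ^ 5‖ < 1 := by
    rw [norm_pow]; exact pow_lt_one₀ (norm_nonneg q) hq (by norm_num)
  have hq50 : q ^ 5 ≠ 0 := pow_ne_zero 5 hq0
  have hs := summable_norm_theta hq hq0 one_ne_zero
  have hs5 := summable_norm_theta hq5 hq50 one_ne_zero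
  have hs1 := summable_norm_theta hq5 hq50 hq0
  have hs2 := summable_norm_theta hq5 hq50 (pow_ne_zero 2 hq0)
  rw [sq, sq, tsum_mul_tsum_of_summable_norm hs hs, tsum_mul_tsum_of_summable_norm hs5 hs5,
    tsum_mul_tsum_of_summable_norm hs1 hs2,
    ← (Equiv.ofBijective _ latticeCoset_bijective).tsum_eq]
  have hsum := (Equiv.ofBijective _ latticeCoset_bijective).summable_iff.mpr
    (summable_mul_of_summable_norm hs hs)
  simp only [Function.comp_def] at hsum
  rw [hsum.tsum_prod, tsum_fintype, Fin.sum_univ_succ, ← tsum_mul_left]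
  have hpow (e : ℤ) : (q ^ 5) ^ e = q ^ (5 * e) := by
    rw [zpow_mul]; norm_cast
  have hpow2 (e : ℤ) : (q ^ 2) ^ e = q ^ (2 * e) := by
    rw [zpow_mul]; norm_cast
  congr 1
  · refine tsum_congr fun ⟨m, n⟩ => ?_
    simp only [Equiv.ofBijective_apply, one_zpow, mul_one, hpow]
    rw [← zpow_add₀ hq0, ← zpow_add₀ hq0, ← zpow_one_add₀ hq0,
      ← triangular_add_triangular_central]
    rfl
  · trans ∑ _i : Fin 4, ∑' p : ℤ × ℤ,
      (q ^ 5) ^ triangular p.1 * q ^ p.1 * ((q ^ 5) ^ triangular p.2 * (q ^ 2) ^ p.2)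
    · refine Finset.sum_congr rfl fun i _ => tsum_congr fun ⟨m, n⟩ => ?_
      simp only [Equiv.ofBijective_apply, one_zpow, mul_one, hpow, hpow2]
      rw [← zpow_add₀ hq0, ← zpow_add₀ hq0, ← zpow_add₀ hq0, ← zpow_add₀ hq0,
        triangular_latticeCoset_of_ne_zero (Fin.succ_ne_zero i)]
    · simp

end Quintisection

theorem tsum_theta_one {q : ℂ} (hq0 : q ≠ 0) (hq : ‖q‖ < 1) :
    ∑' j : ℤ, q ^ triangular j * 1 ^ j = 2 * (E (q ^ 2) ^ 2 / E q) := by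
  have hE := E_ne_zero hq
  rw [tsum_theta_eq hq0 hq one_ne_zero, qp_eq_one_sub_mul hq (-1), inv_one, one_mul, neg_one_mul,
    ← E_mul_qp_neg hq]
  field_simp
  ring

theorem tsum_theta_mul_tsum_theta {q : ℂ} (hq0 : q ≠ 0) (hq : ‖q‖ < 1) :
    (∑' j : ℤ, (q ^ 5) ^ triangular j * q ^ j) * ∑' j : ℤ, (q ^ 5) ^ triangular j * (q ^ 2) ^ j
      = E (q ^ 2) * E (q ^ 5) ^ 3 / (E q * E (q ^ 10)) := by
  have hq5 : ‖q ^ 5‖ < 1 := by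
    rw [norm_pow]; exact pow_lt_one₀ (norm_nonneg q) hq (by norm_num)
  have hq10 : ‖q ^ 10‖ < 1 := by
    rw [norm_pow]; exact pow_lt_one₀ (norm_nonneg q) hq (by norm_num)
  have hq50 : q ^ 5 ≠ 0 := pow_ne_zero 5 hq0
  rw [tsum_theta_eq hq50 hq5 hq0, tsum_theta_eq hq50 hq5 (pow_ne_zero 2 hq0),
    show q⁻¹ * q ^ 5 = q ^ 4 by field_simp, show (q ^ 2)⁻¹ * q ^ 5 = q ^ 3 by field_simp]
  have h1 := E_mul_qp_neg hq
  have h5 := E_mul_qp_neg hq5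
  rw [← pow_mul] at h5
  rw [qp_eq_prod_five hq] at h1
  simp only [neg_mul, ← pow_succ'] at h1
  rw [← pow_two] at h1
  norm_num only at h1 h5
  rw [eq_div_iff (mul_ne_zero (E_ne_zero hq) (E_ne_zero hq10)), ← h1, ← h5]
  ring

theorem stmt_1 : ∀ q : ℂ, ‖q‖ < 1 →
    E (q ^ 2) ^ 4 / E q ^ 2 - q * E (q ^ 10) ^ 4 / E (q ^ 5) ^ 2
      = E (q ^ 2) * E (q ^ 5) ^ 3 / (E q * E (q ^ 10)) := by
  intro q hq
  rcases eq_or_ne q 0 with rfl | hq0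
  · simp [E]
  have hq5 : ‖q ^ 5‖ < 1 := by
    rw [norm_pow]; exact pow_lt_one₀ (norm_nonneg q) hq (by norm_num)
  have h := tsum_theta_sq hq0 hq
  rw [tsum_theta_one hq0 hq, tsum_theta_one (pow_ne_zero 5 hq0) hq5,
    tsum_theta_mul_tsum_theta hq0 hq, ← pow_mul] at h
  norm_num only at h
  linear_combination h / 4
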